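/- Let n ≥ 1 and k ≥ 1 be integers. The expected number of blocks of a partition chosen uniformly at random from NC^k(n) is (kn+1)/(k+1); equivalently, (k+1) times the sum of the number of blocks of π over all π in NC^k(n) equals (kn+1) times the number of elements of NC^k(n). -/

import Mathlib

open Finset

/-- A finpartition of `{0,…,n-1}` (representing `{1,…,n}`) is non-crossing if there are no
`a < b < c < d` with `a, c` in one block and `b, d` in a different block. -/
def IsNoncrossing {n : ℕ} (π : Finpartition (Finset.univ : Finset (Fin n))) : Prop :=
  ∀ a b c d : Fin n, a < b → b < c → c < d →
    ∀ B ∈ π.parts, ∀ C ∈ π.parts, a ∈ B → c ∈ B → b ∈ C → d ∈ C → B = C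

/-- Filter by an arbitrary (possibly non-decidable) predicate. -/
noncomputable def fil {α : Type*} (s : Finset α) (p : α → Prop) : Finset α :=
  letI := Classical.decPred p
  s.filter p

/-- `NC n` : the set of non-crossing partitions of `{1,…,n}`. -/
noncomputable def NC (n : ℕ) : Finset (Finpartition (Finset.univ : Finset (Fin n))) :=
  fil Finset.univ IsNoncrossing

/-- `NCdiv k n` : the set of `k`-divisible non-crossing partitions of `{1,…,kn}`
(all blocks have size divisible by `k`). -/
noncomputable def NCdiv (k n : ℕ) : Finset (Finpartition (Finset.univ : Finset (Fin (k * n)))) :=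
  fil Finset.univ (fun π => IsNoncrossing π ∧ ∀ B ∈ π.parts, k ∣ B.card)

/-- `NCeq k n` : the set of `k`-equal non-crossing partitions of `{1,…,kn}`
(all blocks have size exactly `k`). -/
noncomputable def NCeq (k n : ℕ) : Finset (Finpartition (Finset.univ : Finset (Fin (k * n)))) :=
  fil Finset.univ (fun π => IsNoncrossing π ∧ ∀ B ∈ π.parts, B.card = k)

/-- The number of blocks of `π` of size `i`. -/
def blockCount {n : ℕ} (π : Finpartition (Finset.univ : Finset (Fin n))) (i : ℕ) : ℕ :=
  (π.parts.filter (fun B => B.card = i)).card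


/-- Height of the Lukasiewicz path. -/
def Hgt (f : ℕ → ℕ) (i : ℕ) : ℤ := ∑ j ∈ range i, ((f j : ℤ) - 1)

lemma Hgt_succ (f : ℕ → ℕ) (i : ℕ) : Hgt f (i+1) = Hgt f i + ((f i : ℤ) - 1) := by
  rw [Hgt, sum_range_succ]; rfl

/-- The opener of position `j`. -/
noncomputable def opn (f : ℕ → ℕ) (j : ℕ) : ℕ := Nat.findGreatest (fun i => Hgt f i ≤ Hgt f (j+1)) j

structure NCfun (m : ℕ) (b : ℕ → ℕ) : Prop where
  le : ∀ x < m, b x ≤ x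
  idem : ∀ x < m, b (b x) = b x
  nc : ∀ w x y z, w < x → x < y → y < z → z < m → b w = b y → b x = b z → b w = b x

lemma opn_le (f : ℕ → ℕ) (j : ℕ) : opn f j ≤ j := Nat.findGreatest_le j

lemma opn_gt (f : ℕ → ℕ) (j i : ℕ) (h : opn f j < i) (hi : i ≤ j) : Hgt f (j+1) < Hgt f i := by
  have := Nat.findGreatest_is_greatest h hi
  simpa using this

lemma opn_spec (f : ℕ → ℕ) (j : ℕ) (h : 0 ≤ Hgt f (j+1)) : Hgt f (opn f j) ≤ Hgt f (j+1) :=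
  Nat.findGreatest_spec (P := fun i => Hgt f i ≤ Hgt f (j+1)) (Nat.zero_le j) (by simpa [Hgt] using h)

lemma opn_eq (f : ℕ → ℕ) (j p : ℕ) (hp : p ≤ j) (h1 : Hgt f p ≤ Hgt f (j+1))
    (h2 : ∀ i, p < i → i ≤ j → Hgt f (j+1) < Hgt f i) : opn f j = p := by
  rw [opn, Nat.findGreatest_eq_iff]
  refine ⟨hp, fun _ => h1, fun i hi hij => ?_⟩
  have := h2 i hi hij
  simpa using this

lemma opn_pos (f : ℕ → ℕ) (j : ℕ) : Hgt f (j+1) ≤ Hgt f (opn f j + 1) := by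
  rcases (opn_le f j).eq_or_lt with h1 | h1
  · rw [h1]
  · exact (opn_gt f j _ (Nat.lt_succ_self _) h1).le

lemma opn_NC (m : ℕ) (f : ℕ → ℕ) (h0 : ∀ i ≤ m, 0 ≤ Hgt f i) : NCfun m (opn f) where
  le x _ := opn_le f x
  idem x hx := by
    have h := h0 (x+1) hx
    apply opn_eq _ _ _ le_rfl
    · exact (opn_spec f x h).trans (opn_pos f x)
    · intro i hi hi'; omega
  nc w x y z hw hx hy hz h1 h2 := by
    have sy := opn_spec f y (h0 _ (by omega))
    have sz := opn_spec f z (h0 _ (by omega))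
    have lw := opn_le f w
    have lx := opn_le f x
    rcases lt_trichotomy (opn f w) (opn f x) with h | h | h
    · have a1 := opn_gt f y (opn f x) (by omega) (by omega)
      have a2 := opn_gt f z (y+1) (by omega) (by omega)
      rw [← h2] at sz
      omega
    · exact h
    · have a1 := opn_gt f x (opn f w) (by omega) (by omega)
      have a2 := opn_gt f y (x+1) (by omega) (by omega)
      rw [← h1] at sy
      omega

lemma opn_card (m : ℕ) (f : ℕ → ℕ) (h0 : ∀ i ≤ m, 0 ≤ Hgt f i) (hm : Hgt f m = 0) (p : ℕ)
    (hp : p < m) : #{x ∈ range m | opn f x = p} = f p := by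
  have : #{x ∈ range m | opn f x = p} = #(Finset.Icc (Hgt f p) (Hgt f (p+1))) := by
    apply card_bij (fun x _ => Hgt f (x+1))
    · intro x hx
      simp only [mem_filter, mem_range] at hx
      obtain ⟨hx, rfl⟩ := hx
      exact mem_Icc.2 ⟨opn_spec f x (h0 _ hx), opn_pos f x⟩
    · intro x hx y hy hxy
      simp only [mem_filter, mem_range] at hx hy
      have lx := opn_le f x
      have ly := opn_le f y
      rcases lt_trichotomy x y with h | h | h
      · have := opn_gt f y (x+1) (by omega) (by omega); omega
      · exact h
      · have := opn_gt f x (y+1) (by omega) (by omega); omega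
    · intro v hv
      rw [mem_Icc] at hv
      have hv0 : 0 ≤ v := (h0 p hp.le).trans hv.1
      have hex : ∃ j, p ≤ j ∧ Hgt f (j+1) ≤ v := ⟨m-1, by omega, by
        rw [Nat.sub_add_cancel (by omega), hm]; exact hv0⟩
      classical
      obtain ⟨hj1, hj2⟩ := Nat.find_spec hex
      have hmin := fun i => Nat.find_min hex (m := i)
      have hjm : Nat.find hex ≤ m - 1 := Nat.find_min' hex ⟨by omega, by
        rw [Nat.sub_add_cancel (by omega), hm]; exact hv0⟩
      generalize Nat.find hex = j at *
      have hjv : ∀ i, p < i → i ≤ j → v < Hgt f i := by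
        intro i h1 h2
        have := hmin (i-1) (by omega)
        rw [Nat.sub_add_cancel (by omega)] at this
        by_contra hc
        exact this ⟨by omega, by omega⟩
      have hje : Hgt f (j+1) = v := by
        rcases hj1.eq_or_lt with h | h
        · subst h; omega
        · have := hjv j h le_rfl
          have := Hgt_succ f j
          omega
      refine ⟨j, ?_, hje⟩
      simp only [mem_filter, mem_range]
      refine ⟨by omega, opn_eq f j p hj1 (by omega) ?_⟩
      intro i h1 h2
      have := hjv i h1 h2
      omega
  rw [this, Int.card_Icc, Hgt_succ]
  omega

lemma Hgt_fib (m : ℕ) (b : ℕ → ℕ) (hb : NCfun m b) (f : ℕ → ℕ)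
    (hf : ∀ p < m, #{x ∈ range m | b x = p} = f p) (i : ℕ) (hi : i ≤ m) :
    Hgt f i = #{x ∈ range m | i ≤ x ∧ b x < i} := by
  have h1 : Hgt f i = (∑ j ∈ range i, f j : ℕ) - (i : ℤ) := by simp [Hgt]
  have h2 : ∑ j ∈ range i, f j = #{x ∈ range m | b x < i} := by
    rw [card_eq_sum_card_fiberwise (f := b) (t := range i)]
    · apply sum_congr rfl
      intro j hj
      rw [mem_range] at hj
      rw [← hf j (by omega), filter_filter]
      congr 1
      ext x; simp; omega
    · intro x hx; simpa using (by simpa using hx : x < m ∧ b x < i).2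
  have h3 : #{x ∈ range m | b x < i} = #{x ∈ range m | i ≤ x ∧ b x < i} + #(range i) := by
    rw [← card_union_of_disjoint]
    · congr 1
      ext x
      have := hb.le x
      simp only [mem_filter, mem_union, mem_range]
      by_cases x < m <;> grind
    · rw [disjoint_left]; intro x; simp; omega
  rw [card_range] at h3
  omega

lemma opn_fib (m : ℕ) (b : ℕ → ℕ) (hb : NCfun m b) (f : ℕ → ℕ)
    (hf : ∀ p < m, #{x ∈ range m | b x = p} = f p) (j : ℕ) (hj : j < m) :
    opn f j = b j := by
  have hl := hb.le j hj
  have hid := hb.idem j hj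
  apply opn_eq _ _ _ hl
  · rw [Hgt_fib m b hb f hf _ (by omega), Hgt_fib m b hb f hf _ (by omega)]
    norm_cast
    apply card_le_card
    intro x
    simp only [mem_filter, mem_range]
    rintro ⟨hx, h1, h2⟩
    refine ⟨hx, ?_, by omega⟩
    by_contra hc
    have hne : x ≠ j := by rintro rfl; omega
    have hne' : x ≠ b j := by rintro rfl; omega
    have := hb.nc (b x) (b j) x j h2 (by omega) (by omega) hj (hb.idem x hx) hid
    have := hb.idem x hx
    omega
  · intro i h1 h2
    rw [Hgt_fib m b hb f hf _ (by omega), Hgt_fib m b hb f hf _ (by omega)]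
    norm_cast
    apply card_lt_card
    rw [ssubset_iff_of_subset]
    · exact ⟨j, by simp; omega, by simp⟩
    · intro x
      simp only [mem_filter, mem_range]
      rintro ⟨hx, h3, h4⟩
      refine ⟨hx, by omega, ?_⟩
      by_contra hc
      have hix := hb.idem x hx
      have hne : b x ≠ j := by intro h; rw [h] at hix; omega
      have := hb.nc (b j) (b x) j x (by omega) (by omega) (by omega) hx hid hix
      omega

/-- Periodic extension of a cyclic word, scaled by `k`. -/
def pext (k m : ℕ) (g : Fin (m+1) → ℕ) (j : ℕ) : ℕ := k * g (Fin.ofNat (m+1) j)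

def rotw {m : ℕ} (r : Fin (m+1)) (g : Fin (m+1) → ℕ) : Fin (m+1) → ℕ := fun i => g (i + r)

def Good (k m : ℕ) (g : Fin (m+1) → ℕ) : Prop := ∀ i ≤ m, 0 ≤ Hgt (pext k m g) i

lemma pext_rot (k m : ℕ) (r : Fin (m+1)) (g : Fin (m+1) → ℕ) (j : ℕ) :
    pext k m (rotw r g) j = pext k m g (r.val + j) := by
  unfold pext rotw
  congr 2
  ext
  simp [Fin.val_add, add_comm]

lemma Hgt_rot (k m : ℕ) (r : Fin (m+1)) (g : Fin (m+1) → ℕ) (i : ℕ) :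
    Hgt (pext k m (rotw r g)) i = Hgt (pext k m g) (r.val + i) - Hgt (pext k m g) r.val := by
  induction i with
  | zero => simp [Hgt]
  | succ i ih => rw [Hgt_succ, ih, ← add_assoc, Hgt_succ, pext_rot]; ring

lemma Hgt_full (k n m : ℕ) (hm : m = k * n) (g : Fin (m+1) → ℕ) (hg : ∑ i, g i = n) :
    Hgt (pext k m g) (m+1) = -1 := by
  have h1 : ∑ j ∈ range (m+1), pext k m g j = k * n := by
    rw [← hg, Finset.mul_sum, Finset.sum_range]
    apply sum_congr rfl
    intro i _
    simp [pext]
  have h2 : Hgt (pext k m g) (m+1) = (∑ j ∈ range (m+1), pext k m g j : ℕ) - ((m+1 : ℕ) : ℤ) := by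
    simp [Hgt]
  rw [h2, h1, hm]; push_cast; ring

lemma Hgt_period (k n m : ℕ) (hm : m = k * n) (g : Fin (m+1) → ℕ) (hg : ∑ i, g i = n) (i : ℕ) :
    Hgt (pext k m g) (i + (m+1)) = Hgt (pext k m g) i - 1 := by
  induction i with
  | zero => rw [zero_add, Hgt_full k n m hm g hg]; simp [Hgt]
  | succ i ih =>
    rw [add_right_comm, Hgt_succ, ih, Hgt_succ]
    have : pext k m g (i + (m+1)) = pext k m g i := by
      unfold pext; congr 2; ext; simp
    rw [this]; ring

lemma cycle_lemma (k n m : ℕ) (hm : m = k * n) (g : Fin (m+1) → ℕ) (hg : ∑ i, g i = n) :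
    ∃! r : Fin (m+1), Good k m (rotw r g) := by
  have hper := Hgt_period k n m hm g hg
  set P := Hgt (pext k m g) with hP
  have hgood : ∀ r : Fin (m+1), Good k m (rotw r g) ↔ ∀ i ≤ m, P r.val ≤ P (r.val + i) := by
    intro r
    unfold Good
    simp only [Hgt_rot, sub_nonneg, hP]
  apply existsUnique_of_exists_of_unique
  · obtain ⟨r0, -, hr0⟩ := exists_min_image (univ : Finset (Fin (m+1))) (fun r => P r.val)
      ⟨0, mem_univ _⟩
    have hex : ∃ r, r < m + 1 ∧ P r ≤ P r0.val := ⟨r0.val, r0.2, le_rfl⟩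
    classical
    obtain ⟨h1, h2⟩ := Nat.find_spec hex
    have hmin := fun i => Nat.find_min hex (m := i)
    generalize Nat.find hex = r at *
    refine ⟨⟨r, h1⟩, (hgood _).2 fun i hi => ?_⟩
    show P r ≤ P (r + i)
    by_cases h : r + i < m + 1
    · have := hr0 ⟨r+i, h⟩ (mem_univ _)
      simp only at this
      omega
    · have h3 := hper (r + i - (m+1))
      rw [Nat.sub_add_cancel (by omega)] at h3
      have h4 := hmin (r + i - (m+1)) (by omega)
      have h5 : P r0.val < P (r + i - (m+1)) := by
        by_contra hc
        exact h4 ⟨by omega, by omega⟩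
      omega
  · have key : ∀ r s : Fin (m+1), r.val < s.val → Good k m (rotw r g) → Good k m (rotw s g) →
        False := by
      intro r s hrs h1 h2
      have a := (hgood r).1 h1 (s.val - r.val) (by omega)
      have b := (hgood s).1 h2 (r.val + (m+1) - s.val) (by omega)
      rw [Nat.add_sub_cancel' (by omega)] at a b
      have := hper r.val
      omega
    intro r s hr hs
    rcases lt_trichotomy r.val s.val with h | h | h
    · exact (key r s h hr hs).elim
    · exact Fin.ext h
    · exact (key s r h hs hr).elim

lemma sum_rot {m : ℕ} (r : Fin (m+1)) (g : Fin (m+1) → ℕ) : ∑ i, rotw r g i = ∑ i, g i :=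
  Equiv.sum_comp (Equiv.addRight r) g

open Classical in
lemma cycle_sum (k n m : ℕ) (hm : m = k * n) (w : (Fin (m+1) → ℕ) → ℕ)
    (hw : ∀ r g, w (rotw r g) = w g) :
    ∑ g ∈ finAntidiagonal (m+1) n, w g =
      (m+1) * ∑ g ∈ finAntidiagonal (m+1) n with Good k m g, w g := by
  have h1 : ∀ g ∈ finAntidiagonal (m+1) n,
      w g = ∑ r : Fin (m+1), if Good k m (rotw r g) then w (rotw r g) else 0 := by
    intro g hg
    rw [mem_finAntidiagonal] at hg
    obtain ⟨r, hr, hu⟩ := cycle_lemma k n m hm g hg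
    rw [sum_eq_single r]
    · rw [if_pos hr, hw]
    · intro s _ hs
      rw [if_neg]
      exact fun h => hs (hu s h)
    · simp
  rw [sum_congr rfl h1, sum_comm]
  have h2 : ∀ r : Fin (m+1), ∑ g ∈ finAntidiagonal (m+1) n,
      (if Good k m (rotw r g) then w (rotw r g) else 0) =
      ∑ g ∈ finAntidiagonal (m+1) n with Good k m g, w g := by
    intro r
    rw [sum_filter]
    apply sum_bij' (fun g _ => rotw r g) (fun g _ => rotw (-r) g)
    · intro g hg; simpa [sum_rot] using hg
    · intro g hg; simpa [sum_rot] using hg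
    · intro g _; funext i; simp [rotw]
    · intro g _; funext i; simp [rotw]
    · intro g _; rfl
  rw [sum_congr rfl (fun r _ => h2 r)]
  simp

lemma card_fa (d n : ℕ) : #(finAntidiagonal d n) = (d + n - 1).choose n := by
  have := card_finsuppAntidiag_nat_eq_choose (s := (univ : Finset (Fin d))) n
  rw [card_univ, Fintype.card_fin] at this
  rw [← this]
  apply card_bij' (fun g _ => Finsupp.equivFunOnFinite.symm g) (fun g _ => (g : Fin d → ℕ))
  · intro g hg; simpa using hg
  · intro g hg; simpa using hg
  · intro g _; rfl
  · intro g _; ext; rfl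

def nz {d : ℕ} (g : Fin d → ℕ) : ℕ := #{i | g i ≠ 0}

lemma nz_rot {m : ℕ} (r : Fin (m+1)) (g : Fin (m+1) → ℕ) : nz (rotw r g) = nz g := by
  unfold nz
  apply card_equiv (Equiv.addRight r)
  intro i
  simp only [mem_filter, mem_univ, true_and]
  rfl

lemma card_pos_at (d n : ℕ) (i : Fin d) :
    #{g ∈ finAntidiagonal d (n+1) | g i ≠ 0} = #(finAntidiagonal d n) := by
  symm
  have hs : ∀ g : Fin d → ℕ, ∑ j, (g + Pi.single i 1 : Fin d → ℕ) j = ∑ j, g j + 1 := by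
    intro g
    simp [sum_add_distrib, Pi.single_apply]
  apply card_bij (fun g _ => g + Pi.single i 1)
  · intro g hg
    rw [mem_finAntidiagonal] at hg
    rw [mem_filter, mem_finAntidiagonal, hs, hg]
    simp
  · intro g _ h _ e; exact add_right_cancel e
  · intro g hg
    rw [mem_filter, mem_finAntidiagonal] at hg
    have e : g - Pi.single i 1 + Pi.single i 1 = g := by
      funext j
      by_cases h : j = i
      · subst h; simp; omega
      · simp [h]
    refine ⟨g - Pi.single i 1, ?_, e⟩
    rw [mem_finAntidiagonal]
    have := hs (g - Pi.single i 1)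
    rw [e] at this
    omega

lemma sum_nz (d n : ℕ) : ∑ g ∈ finAntidiagonal d (n+1), nz g = d * #(finAntidiagonal d n) := by
  simp only [nz, card_filter]
  rw [sum_comm]
  simp only [← card_filter]
  rw [sum_congr rfl (fun i _ => card_pos_at d n i)]
  simp

open Classical in
lemma good_count (k n m : ℕ) (hn : 1 ≤ n) (hm : m = k * n) :
    (k + 1) * ∑ g ∈ finAntidiagonal (m+1) n with Good k m g, nz g =
      (m + 1) * #{g ∈ finAntidiagonal (m+1) n | Good k m g} := by
  have h1 := cycle_sum k n m hm (fun _ => 1) (fun _ _ => rfl)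
  have h2 := cycle_sum k n m hm nz nz_rot
  simp only [sum_const, smul_eq_mul, mul_one] at h1
  obtain ⟨n, rfl⟩ := Nat.exists_eq_add_of_le' hn
  rw [sum_nz] at h2
  have h3 : (k+1) * #(finAntidiagonal (m+1) n) = #(finAntidiagonal (m+1) (n+1)) := by
    rw [card_fa, card_fa]
    have := Nat.add_one_mul_choose_eq (m+n) n
    have e1 : m + 1 + n - 1 = m + n := by omega
    have e2 : m + 1 + (n+1) - 1 = m + n + 1 := by omega
    rw [e1, e2]
    apply Nat.eq_of_mul_eq_mul_right (Nat.succ_pos n)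
    rw [Nat.succ_eq_add_one, ← this, hm]
    ring
  have h4 := Nat.eq_of_mul_eq_mul_left (Nat.succ_pos m) h2
  rw [← h4, h3, h1]

section dict
variable {m : ℕ} (π : Finpartition (Finset.univ : Finset (Fin m)))

/-- Minimum of the block of `x`. -/
def bmin (x : Fin m) : Fin m := (π.part x).min' ⟨x, π.mem_part (mem_univ x)⟩

lemma bmin_mem (x : Fin m) : bmin π x ∈ π.part x := min'_mem _ _

lemma bmin_le (x y : Fin m) (h : y ∈ π.part x) : bmin π x ≤ y := min'_le _ _ h

lemma mem_part_iff (x y : Fin m) : y ∈ π.part x ↔ bmin π y = bmin π x := by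
  constructor
  · intro h
    have := (π.mem_part_iff_part_eq_part (mem_univ y) (mem_univ x)).1 h
    unfold bmin
    simp only [this]
  · intro h
    have h1 := bmin_mem π y
    have h2 := bmin_mem π x
    rw [h] at h1
    have := π.eq_of_mem_parts (π.part_mem.2 (mem_univ y)) (π.part_mem.2 (mem_univ x)) h1 h2
    rw [← this]; exact π.mem_part (mem_univ y)

lemma bmin_idem (x : Fin m) : bmin π (bmin π x) = bmin π x :=
  (mem_part_iff π _ _).1 (bmin_mem π x)

/-- Natural number version. -/
def nmin (x : ℕ) : ℕ := if h : x < m then (bmin π ⟨x, h⟩).val else x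

lemma nmin_val (x : Fin m) : nmin π x.val = (bmin π x).val := by simp [nmin]

lemma nmin_NC (h : IsNoncrossing π) : NCfun m (nmin π) where
  le x hx := by
    have := bmin_le π ⟨x, hx⟩ ⟨x, hx⟩ (π.mem_part (mem_univ _))
    rw [nmin_val π ⟨x, hx⟩]; exact this
  idem x hx := by
    rw [nmin_val π ⟨x, hx⟩, nmin_val, bmin_idem]
  nc w x y z hw hx hy hz h1 h2 := by
    have hy' : y < m := by omega
    have hx' : x < m := by omega
    have hw' : w < m := by omega
    rw [nmin_val π ⟨w, hw'⟩, nmin_val π ⟨y, hy'⟩] at h1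
    rw [nmin_val π ⟨x, hx'⟩, nmin_val π ⟨z, hz⟩] at h2
    rw [nmin_val π ⟨w, hw'⟩, nmin_val π ⟨x, hx'⟩]
    have := h ⟨w, hw'⟩ ⟨x, hx'⟩ ⟨y, hy'⟩ ⟨z, hz⟩ hw hx hy
      (π.part ⟨w, hw'⟩) (π.part_mem.2 (mem_univ _)) (π.part ⟨x, hx'⟩) (π.part_mem.2 (mem_univ _))
      (π.mem_part (mem_univ _)) ((mem_part_iff π _ _).2 (Fin.ext h1.symm))
      (π.mem_part (mem_univ _)) ((mem_part_iff π _ _).2 (Fin.ext h2.symm))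
    unfold bmin
    simp only [this]

lemma fib_card (x : Fin m) : #{y ∈ range m | nmin π y = nmin π x} = #(π.part x) := by
  symm
  apply card_bij (fun y _ => y.val)
  · intro y hy
    rw [mem_part_iff] at hy
    simp [nmin_val, hy]
  · intro a _ b _ h; exact Fin.ext h
  · intro y hy
    simp only [mem_filter, mem_range] at hy
    refine ⟨⟨y, hy.1⟩, ?_, rfl⟩
    rw [mem_part_iff]
    apply Fin.ext
    rw [← nmin_val, ← nmin_val]; exact hy.2

lemma card_parts : #π.parts = #((range m).image (nmin π)) := by
  symm
  have hlt : ∀ p ∈ (range m).image (nmin π), p < m := by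
    intro p hp
    rw [mem_image] at hp
    obtain ⟨x, hx, rfl⟩ := hp
    rw [nmin_val π ⟨x, mem_range.1 hx⟩]
    exact (bmin π _).2
  refine card_bij' (fun p hp => π.part ⟨p, hlt p hp⟩)
    (fun B hB => (B.min' (π.nonempty_of_mem_parts hB)).val) ?_ ?_ ?_ ?_
  · intro p hp; exact π.part_mem.2 (mem_univ _)
  · intro B hB
    have h1 : B.min' (π.nonempty_of_mem_parts hB) ∈ B := min'_mem _ _
    have h2 := π.part_eq_of_mem hB h1
    rw [mem_image]
    refine ⟨_, mem_range.2 (B.min' (π.nonempty_of_mem_parts hB)).2, ?_⟩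
    rw [nmin_val]
    unfold bmin
    simp only [h2]
  · intro p hp
    rw [mem_image] at hp
    obtain ⟨x, hx, rfl⟩ := hp
    have := bmin_idem π ⟨x, mem_range.1 hx⟩
    rw [Fin.ext_iff, ← nmin_val] at this
    simpa [nmin, mem_range.1 hx, bmin] using this
  · intro B hB
    exact π.part_eq_of_mem hB (min'_mem _ (π.nonempty_of_mem_parts hB))

lemma eq_of_nmin (π' : Finpartition (Finset.univ : Finset (Fin m)))
    (h : ∀ x < m, nmin π x = nmin π' x) : π = π' := by
  have hp : ∀ x, π.part x = π'.part x := by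
    intro x; ext y
    rw [mem_part_iff, mem_part_iff, Fin.ext_iff, Fin.ext_iff, ← nmin_val, ← nmin_val,
      ← nmin_val, ← nmin_val, h _ x.2, h _ y.2]
  have hs : ∀ σ τ : Finpartition (Finset.univ : Finset (Fin m)), (∀ x, σ.part x = τ.part x) →
      σ.parts ⊆ τ.parts := by
    intro σ τ h B hB
    obtain ⟨x, hx⟩ := σ.nonempty_of_mem_parts hB
    rw [← σ.part_eq_of_mem hB hx, h]
    exact τ.part_mem.2 (mem_univ _)
  ext1
  exact Subset.antisymm (hs _ _ hp) (hs _ _ (fun x => (hp x).symm))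

lemma exists_of_NC (b : ℕ → ℕ) (hb : NCfun m b) :
    ∃ π : Finpartition (Finset.univ : Finset (Fin m)), IsNoncrossing π ∧ ∀ x < m, nmin π x = b x := by
  classical
  let s : Setoid (Fin m) := Setoid.ker (fun x : Fin m => b x.val)
  have hmem : ∀ x y, y ∈ (Finpartition.ofSetoid s).part x ↔ b x.val = b y.val := by
    intro x y
    rw [Finpartition.mem_part_ofSetoid_iff_rel]
    rfl
  generalize Finpartition.ofSetoid s = π at hmem
  have hpart : ∀ B ∈ π.parts, ∀ x ∈ B, ∀ y ∈ B, b x.val = b y.val := by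
    intro B hB x hx y hy
    rw [← hmem, π.part_eq_of_mem hB hx]
    exact hy
  refine ⟨π, ?_, ?_⟩
  · intro w x y z hw hx hy B hB C hC h1 h2 h3 h4
    have := hb.nc w x y z hw hx hy z.2 (hpart B hB _ h1 _ h2) (hpart C hC _ h3 _ h4)
    rw [← hmem, π.part_eq_of_mem hB h1] at this
    exact π.eq_of_mem_parts hB hC this h3
  · intro x hx
    have hl := hb.le x hx
    have h1 := bmin_mem π ⟨x, hx⟩
    rw [hmem] at h1
    have h2 := bmin_le π ⟨x, hx⟩ ⟨b x, by omega⟩ ((hmem _ _).2 (hb.idem x hx).symm)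
    have h3 := hb.le _ (bmin π ⟨x, hx⟩).2
    rw [nmin_val π ⟨x, hx⟩]
    rw [Fin.le_def] at h2
    simp only at h1 h2
    omega

end dict

/-- The cyclic word of a partition. -/
def wordOf (k : ℕ) {m : ℕ} (π : Finpartition (Finset.univ : Finset (Fin m))) : Fin (m+1) → ℕ :=
  fun i => #{x ∈ range m | nmin π x = i.val} / k

lemma mem_NCdiv (k n : ℕ) (π : Finpartition (Finset.univ : Finset (Fin (k * n)))) :
    π ∈ NCdiv k n ↔ IsNoncrossing π ∧ ∀ B ∈ π.parts, k ∣ B.card := by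
  simp [NCdiv, fil]

lemma fib_dvd (k : ℕ) {m : ℕ} (π : Finpartition (Finset.univ : Finset (Fin m)))
    (h : ∀ B ∈ π.parts, k ∣ B.card) (p : ℕ) : k ∣ #{x ∈ range m | nmin π x = p} := by
  by_cases hp : ∃ x < m, nmin π x = p
  · obtain ⟨x, hx, rfl⟩ := hp
    rw [fib_card π ⟨x, hx⟩]
    exact h _ (π.part_mem.2 (mem_univ _))
  · rw [filter_eq_empty_iff.2]
    · simp
    · intro x hx hxp
      exact hp ⟨x, mem_range.1 hx, hxp⟩

lemma pext_wordOf (k : ℕ) {m : ℕ} (π : Finpartition (Finset.univ : Finset (Fin m)))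
    (h : ∀ B ∈ π.parts, k ∣ B.card) (p : ℕ) (hp : p < m + 1) :
    #{x ∈ range m | nmin π x = p} = pext k m (wordOf k π) p := by
  have := Nat.mul_div_cancel' (fib_dvd k π h p)
  simp only [pext, wordOf, Fin.val_ofNat, Nat.mod_eq_of_lt hp]
  exact this.symm

lemma wordOf_sum (k n : ℕ) (hk : 1 ≤ k) (π : Finpartition (Finset.univ : Finset (Fin (k * n))))
    (hnc : IsNoncrossing π) (h : ∀ B ∈ π.parts, k ∣ B.card) : ∑ i, wordOf k π i = n := by
  apply Nat.eq_of_mul_eq_mul_left hk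
  rw [mul_sum]
  have h1 : ∀ i : Fin (k*n+1), k * wordOf k π i = #{x ∈ range (k*n) | nmin π x = i.val} :=
    fun i => Nat.mul_div_cancel' (fib_dvd k π h i)
  rw [sum_congr rfl (fun i _ => h1 i)]
  rw [← Finset.sum_range (fun i => #{x ∈ range (k*n) | nmin π x = i})]
  rw [← card_eq_sum_card_fiberwise, card_range]
  intro x hx
  simp only [coe_range, Set.mem_Iio] at hx ⊢
  have := (nmin_NC π hnc).le x hx
  omega

lemma wordOf_nz (k n : ℕ) (hk : 1 ≤ k) (π : Finpartition (Finset.univ : Finset (Fin (k * n))))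
    (hnc : IsNoncrossing π) (h : ∀ B ∈ π.parts, k ∣ B.card) : nz (wordOf k π) = #π.parts := by
  rw [card_parts, nz]
  have h1 : ∀ i : Fin (k*n+1), wordOf k π i ≠ 0 ↔ ∃ x < k * n, nmin π x = i.val := by
    intro i
    have h2 : k * wordOf k π i = #{x ∈ range (k*n) | nmin π x = i.val} :=
      Nat.mul_div_cancel' (fib_dvd k π h i)
    rw [← Nat.pos_iff_ne_zero, ← Nat.mul_pos_iff_of_pos_left hk, h2, card_pos]
    simp [Finset.Nonempty]
  apply card_bij (fun i _ => i.val)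
  · intro i hi
    simpa [h1] using hi
  · intro i _ j _ e; exact Fin.ext e
  · intro p hp
    simp only [mem_image, mem_range] at hp
    obtain ⟨x, hx, rfl⟩ := hp
    have := (nmin_NC π hnc).le x hx
    refine ⟨⟨nmin π x, by omega⟩, ?_, rfl⟩
    simp only [mem_filter, mem_univ, true_and, h1]
    exact ⟨x, hx, rfl⟩

open Classical in
lemma transfer (k n : ℕ) (hk : 1 ≤ k) (w : ℕ → ℕ) :
    ∑ π ∈ NCdiv k n, w (#π.parts) =
      ∑ g ∈ finAntidiagonal (k*n+1) n with Good k (k*n) g, w (nz g) := by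
  apply sum_bij (fun π _ => wordOf k π)
  · intro π hπ
    rw [mem_NCdiv] at hπ
    rw [mem_filter, mem_finAntidiagonal]
    refine ⟨wordOf_sum k n hk π hπ.1 hπ.2, fun i hi => ?_⟩
    rw [Hgt_fib (k*n) (nmin π) (nmin_NC π hπ.1) _
      (fun p hp => pext_wordOf k π hπ.2 p (by omega)) i hi]
    positivity
  · intro π hπ π' hπ' e
    rw [mem_NCdiv] at hπ hπ'
    apply eq_of_nmin
    intro x hx
    rw [← opn_fib (k*n) (nmin π) (nmin_NC π hπ.1) _
      (fun p hp => pext_wordOf k π hπ.2 p (by omega)) x hx,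
      ← opn_fib (k*n) (nmin π') (nmin_NC π' hπ'.1) _
      (fun p hp => pext_wordOf k π' hπ'.2 p (by omega)) x hx]
    rw [e]
  · intro g hg
    rw [mem_filter, mem_finAntidiagonal] at hg
    obtain ⟨hsum, hgood⟩ := hg
    have hfull := Hgt_full k n _ rfl g hsum
    have hlast := hgood (k*n) le_rfl
    have hstep := Hgt_succ (pext k (k*n) g) (k*n)
    have hm0 : Hgt (pext k (k*n) g) (k*n) = 0 := by omega
    have hl0 : pext k (k*n) g (k*n) = 0 := by omega
    have hNC := opn_NC (k*n) _ hgood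
    obtain ⟨π, hπ, hmin⟩ := exists_of_NC _ hNC
    have hcard : ∀ p < k*n, #{x ∈ range (k*n) | nmin π x = p} = pext k (k*n) g p := by
      intro p hp
      rw [← opn_card (k*n) _ hgood hm0 p hp]
      congr 1
      apply filter_congr
      intro x hx
      rw [hmin x (mem_range.1 hx)]
    refine ⟨π, ?_, ?_⟩
    · rw [mem_NCdiv]
      refine ⟨hπ, fun B hB => ?_⟩
      obtain ⟨x, hx⟩ := π.nonempty_of_mem_parts hB
      rw [← π.part_eq_of_mem hB hx, ← fib_card, hcard _ (by rw [nmin_val]; exact (bmin π x).2)]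
      exact Dvd.intro _ rfl
    · funext i
      have hcard' : #{x ∈ range (k*n) | nmin π x = i.val} = pext k (k*n) g i.val := by
        rcases (Nat.lt_succ_iff.1 i.2).eq_or_lt with h | h
        · rw [h, hl0, card_eq_zero, filter_eq_empty_iff]
          intro x hx hxe
          rw [mem_range] at hx
          have := (nmin_NC π hπ).le x hx
          omega
        · exact hcard _ h
      rw [wordOf, hcard', pext, Nat.mul_div_cancel_left _ hk]
      simp
  · intro π hπ
    rw [mem_NCdiv] at hπ
    rw [wordOf_nz k n hk π hπ.1 hπ.2]

/-- The expected number of blocks of a `k`-divisible non-crossing partition of `{1,…,kn}`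
chosen uniformly at random is `(kn+1)/(k+1)`. -/
theorem expected_number_of_blocks (n k : ℕ) (hn : 1 ≤ n) (hk : 1 ≤ k) :
    (k + 1) * ∑ π ∈ NCdiv k n, π.parts.card = (k * n + 1) * (NCdiv k n).card := by
  have h1 := transfer k n hk id
  have h2 := transfer k n hk (fun _ => 1)
  simp only [id] at h1
  simp only [sum_const, smul_eq_mul, mul_one] at h2
  rw [h1, h2]
  exact good_count k n (k*n) hn rfl
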